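/- arXiv:2404.11037 — 8 statements merged into one kernel-verified Lean document; each statement's English description precedes it below -/
import Mathlib

section
/- Let k be a field and d ≥ 2 a natural number such that d·1 ≠ 0 in k. Let n ≥ 1 and let λ₀,…,λₙ ∈ k be pairwise distinct. Let A = (aᵢⱼ)₀≤i,j≤n be an invertible (n+1)×(n+1) matrix over k, and suppose there exist scalars c₀,…,cₙ and c′₀,…,c′ₙ in k such that, as elements of the polynomial ring k[X₀,…,Xₙ], ∑ᵢ (∑ⱼ aᵢⱼ Xⱼ)^d = ∑ᵢ cᵢ Xᵢ^d and ∑ᵢ λᵢ (∑ⱼ aᵢⱼ Xⱼ)^d = ∑ᵢ c′ᵢ Xᵢ^d. Then A is a monomial matrix: there exists a permutation σ of {0,…,n} such that for all i, j one has aᵢⱼ ≠ 0 if and only if i = σ(j). -/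
open MvPolynomial

/-- Differentiating a weighted sum of `d`-th powers of linear forms which equals a diagonal form,
and evaluating at a point where all linear forms but the `i`-th vanish. -/
theorem mul_eq_of_sum_linear_pow_eq_diagonal {k ι : Type*} [Field k] [Fintype ι] [DecidableEq ι]
    {d : ℕ} (hd : 2 ≤ d) (hdk : (d : k) ≠ 0) {A B : Matrix ι ι k} (hAB : A * B = 1)
    {w c : ι → k}
    (h : ∑ i, C (w i) * (∑ j, C (A i j) * X j) ^ d = ∑ i, C (c i) * X i ^ d) (i j : ι) :
    w i * A i j = c j * B j i ^ (d - 1) := by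
  have hev (m : ι) : ∑ l, A m l * B l i = if m = i then 1 else 0 := by
    rw [← Matrix.mul_apply, hAB, Matrix.one_apply]
  have h' := congrArg (fun p => eval (fun l => B l i) (pderiv j p)) h
  have hd1 : d - 1 ≠ 0 := by omega
  simp [Derivation.leibniz, pderiv_X, Pi.single_apply, hev, ite_pow, hd1] at h'
  apply mul_left_cancel₀ hdk
  linear_combination h'

theorem stmt_0 (k : Type*) [Field k] (d n : ℕ) (hd : 2 ≤ d) (hdk : (d : k) ≠ 0)
    (hn : 1 ≤ n) (lam : Fin (n + 1) → k) (hlam : Function.Injective lam)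
    (A : Matrix (Fin (n + 1)) (Fin (n + 1)) k) (hA : IsUnit A)
    (c c' : Fin (n + 1) → k)
    (h1 : ∑ i, (∑ j, C (A i j) * X j) ^ d
        = ∑ i, C (c i) * X i ^ d)
    (h2 : ∑ i, C (lam i) * (∑ j, C (A i j) * X j) ^ d
        = ∑ i, C (c' i) * X i ^ d) :
    ∃ σ : Equiv.Perm (Fin (n + 1)), ∀ i j, A i j ≠ 0 ↔ i = σ j := by
  obtain ⟨B, hAB, hBA⟩ := isUnit_iff_exists.mp hA
  have e1 (i j) : A i j = c j * B j i ^ (d - 1) := by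
    simpa using mul_eq_of_sum_linear_pow_eq_diagonal (w := fun _ => 1) hd hdk hAB
      (by simpa using h1) i j
  have e2 (i j) := mul_eq_of_sum_linear_pow_eq_diagonal hd hdk hAB h2 i j
  have key (i j) (h : A i j ≠ 0) : c j ≠ 0 ∧ lam i * c j = c' j := by
    refine ⟨fun hc => h (by simp [e1, hc]), mul_right_cancel₀ h ?_⟩
    linear_combination c j * e2 i j - c' j * e1 i j
  have col (j) : ∃ i, A i j ≠ 0 := by
    by_contra! h
    simpa [Matrix.mul_apply, h] using congrFun (congrFun hBA j) j
  have row (i) : ∃ j, A i j ≠ 0 := by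
    by_contra! h
    simpa [Matrix.mul_apply, h] using congrFun (congrFun hAB i) i
  choose f hf using col
  have uniq (i j) (h : A i j ≠ 0) : i = f j :=
    hlam (mul_right_cancel₀ (key i j h).1 ((key i j h).2.trans (key _ j (hf j)).2.symm))
  have hsurj : Function.Surjective f := fun i =>
    (row i).imp fun j hj => (uniq i j hj).symm
  refine ⟨Equiv.ofBijective f (Finite.injective_iff_bijective.mp
    (Finite.injective_iff_surjective.mpr hsurj)), fun i j => ⟨uniq i j, ?_⟩⟩
  rintro rfl
  exact hf j
end

section
/- Let k be a field, d ≥ 1 and 1 ≤ r ≤ n natural numbers, and let λ₀,…,λₙ ∈ k be pairwise distinct. For 0 ≤ m ≤ r−1 let F_m := ∑ᵢ λᵢ^m Xᵢ^d be the Fermat forms in k[X₀,…,Xₙ]. Let a₀,…,aₙ ∈ k, and suppose that for every 0 ≤ m ≤ r−1 the polynomial ∑ᵢ λᵢ^m aᵢ^d Xᵢ^d lies in the k-linear span of {F₀,…,F_{r−1}}. Then aᵢ^d = aⱼ^d for all i, j. -/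
open MvPolynomial

theorem MvPolynomial.eval_single_sum_C_mul_X_pow {σ k : Type*} [Fintype σ] [DecidableEq σ]
    [CommSemiring k] {d : ℕ} (hd : d ≠ 0) (c : σ → k) (i : σ) :
    eval (Pi.single i 1) (∑ j, C (c j) * X j ^ d : MvPolynomial σ k) = c i := by
  simp [Pi.single_apply, ite_pow, hd]

/-- A diagonal form of degree `d` in the span of the Fermat forms has its coefficients interpolated
by a polynomial of degree less than `r`. -/
theorem exists_degree_lt_eval_eq_of_mem_span_fermat {σ k : Type*} [Fintype σ] [Field k]
    {d r : ℕ} (hd : d ≠ 0) (lam c : σ → k)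
    (h : (∑ i, C (c i) * X i ^ d : MvPolynomial σ k) ∈
      Submodule.span k (Set.range fun m : Fin r =>
        (∑ i, C (lam i ^ (m : ℕ)) * X i ^ d : MvPolynomial σ k))) :
    ∃ P : Polynomial k, P.degree < r ∧ ∀ i, P.eval (lam i) = c i := by
  classical
  obtain ⟨e, he⟩ := (Submodule.mem_span_range_iff_exists_fun k).1 h
  refine ⟨∑ m : Fin r, Polynomial.C (e m) * Polynomial.X ^ (m : ℕ),
    Polynomial.degree_sum_fin_lt e, fun i => ?_⟩
  rw [← eval_single_sum_C_mul_X_pow hd c i, ← he, map_sum, Polynomial.eval_finsetSum]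
  refine Finset.sum_congr rfl fun m _ => ?_
  rw [smul_eval, eval_single_sum_C_mul_X_pow hd (fun j => lam j ^ (m : ℕ))]
  simp

theorem stmt_2 (k : Type*) [Field k] (d r n : ℕ) (hd : 1 ≤ d) (hr : 1 ≤ r) (hrn : r ≤ n)
    (lam : Fin (n + 1) → k) (hlam : Function.Injective lam)
    (a : Fin (n + 1) → k)
    (h : ∀ m : Fin r,
      (∑ i, C (lam i ^ (m : ℕ) * a i ^ d) * X i ^ d : MvPolynomial (Fin (n + 1)) k) ∈
        Submodule.span k
          (Set.range fun m : Fin r =>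
            (∑ i, C (lam i ^ (m : ℕ)) * X i ^ d : MvPolynomial (Fin (n + 1)) k))) :
    ∀ i j : Fin (n + 1), a i ^ d = a j ^ d := by
  have interp (m : Fin r) := exists_degree_lt_eval_eq_of_mem_span_fermat
    (Nat.one_le_iff_ne_zero.1 hd) lam (fun i => lam i ^ (m : ℕ) * a i ^ d) (h m)
  obtain ⟨P, hP, hPa⟩ := interp ⟨0, hr⟩
  simp only [pow_zero, one_mul] at hPa
  suffices hP0 : P.natDegree = 0 by
    intro i j
    rw [← hPa i, ← hPa j, Polynomial.eq_C_of_natDegree_eq_zero hP0]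
    simp
  by_contra hP0
  have hP_ne : P ≠ 0 := by
    rintro rfl
    simp at hP0
  have hPr : P.natDegree < r := (Polynomial.natDegree_lt_iff_degree_lt hP_ne).2 hP
  -- multiplying `P` by this power of `X` gives a polynomial of degree exactly `r`
  obtain ⟨Q, hQ, hQa⟩ := interp ⟨r - P.natDegree, by lia⟩
  have hdeg : (Polynomial.X ^ (r - P.natDegree) * P).degree = (r : WithBot ℕ) := by
    rw [Polynomial.degree_mul, Polynomial.degree_X_pow, Polynomial.degree_eq_natDegree hP_ne]
    exact_mod_cast Nat.sub_add_cancel hPr.le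
  have hrn' : (r : WithBot ℕ) < (Finset.univ : Finset (Fin (n + 1))).card := by
    rw [Finset.card_fin]
    exact_mod_cast Nat.lt_succ_of_le hrn
  have heq : Polynomial.X ^ (r - P.natDegree) * P = Q :=
    Polynomial.eq_of_degrees_lt_of_eval_index_eq Finset.univ hlam.injOn
      (hdeg ▸ hrn') (hQ.trans hrn') fun i _ => by simp [hPa, hQa]
  rw [← heq, hdeg] at hQ
  exact lt_irrefl _ hQ
end

section
/- Let k be an algebraically closed field, let n and r be natural numbers with 1 < r < n, and let σ be a permutation of {0,…,n} with σ ≠ id. Then there exists a nonzero polynomial F in n+1 variables over k such that: for every tuple (λ₀,…,λₙ) ∈ k^{n+1} with F(λ₀,…,λₙ) ≠ 0, there is no single-variable polynomial p ∈ k[t] of degree ≤ r−1 satisfying p(λᵢ) = λ_{σ(i)} for all 0 ≤ i ≤ n. -/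
/-- The numerator of the value at `t` of the Lagrange interpolant with nodes `v` and values `w`,
cleared of denominators. -/
def interpolateNumerator {ι R : Type*} [CommRing R] [DecidableEq ι] (s : Finset ι)
    (v w : ι → R) (t : R) : R :=
  ∑ i ∈ s, w i * ((∏ l ∈ s.erase i, (t - v l)) *
    ∏ a ∈ s.erase i, ∏ l ∈ s.erase a, (v a - v l))

/-- The common denominator of the Lagrange basis polynomials with nodes `v`. -/
def interpolateDenominator {ι R : Type*} [CommRing R] [DecidableEq ι] (s : Finset ι)
    (v : ι → R) : R :=
  ∏ i ∈ s, ∏ l ∈ s.erase i, (v i - v l)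

theorem map_interpolateNumerator {ι R S : Type*} [CommRing R] [CommRing S] [DecidableEq ι]
    (f : R →+* S) (s : Finset ι) (v w : ι → R) (t : R) :
    f (interpolateNumerator s v w t) =
      interpolateNumerator s (fun i => f (v i)) (fun i => f (w i)) (f t) := by
  simp [interpolateNumerator, map_sum, map_prod]

theorem map_interpolateDenominator {ι R S : Type*} [CommRing R] [CommRing S] [DecidableEq ι]
    (f : R →+* S) (s : Finset ι) (v : ι → R) :
    f (interpolateDenominator s v) = interpolateDenominator s (fun i => f (v i)) := by
  simp [interpolateDenominator, map_prod]

theorem interpolateDenominator_ne_zero_iff {ι K : Type*} [Field K] [DecidableEq ι]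
    (s : Finset ι) (v : ι → K) :
    interpolateDenominator s v ≠ 0 ↔ Set.InjOn v s := by
  simp only [interpolateDenominator, Finset.prod_ne_zero_iff, Finset.mem_erase, sub_ne_zero]
  constructor
  · intro h a ha b hb hab
    by_contra hne
    exact h a ha b ⟨Ne.symm hne, hb⟩ hab
  · intro h a ha b hb hab
    exact hb.1 (h ha hb.2 hab).symm

theorem interpolateNumerator_eq {ι K : Type*} [Field K] [DecidableEq ι]
    (s : Finset ι) (v w : ι → K) (t : K) (hv : Set.InjOn v s) :
    interpolateNumerator s v w t =
      interpolateDenominator s v * (Lagrange.interpolate s v w).eval t := by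
  rw [Lagrange.interpolate_apply, Polynomial.eval_finsetSum, Finset.mul_sum,
    interpolateNumerator]
  refine Finset.sum_congr rfl fun i hi => ?_
  have hne : ∏ l ∈ s.erase i, (v i - v l) ≠ 0 :=
    Finset.prod_ne_zero_iff.mp ((interpolateDenominator_ne_zero_iff s v).mpr hv) i hi
  rw [interpolateDenominator, ← Finset.mul_prod_erase s _ hi]
  simp only [Lagrange.basis, Lagrange.basisDivisor, Polynomial.eval_mul, Polynomial.eval_C,
    Polynomial.eval_prod, Polynomial.eval_sub, Polynomial.eval_X, Finset.prod_mul_distrib,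
    Finset.prod_inv_distrib]
  field_simp

theorem stmt_3 (k : Type*) [Field k] [IsAlgClosed k] (n r : ℕ) (hr : 1 < r) (hrn : r < n)
    (σ : Equiv.Perm (Fin (n + 1))) (hσ : σ ≠ 1) :
    ∃ F : MvPolynomial (Fin (n + 1)) k, F ≠ 0 ∧
      ∀ lam : Fin (n + 1) → k, MvPolynomial.eval lam F ≠ 0 →
        ¬ ∃ p : Polynomial k, p.natDegree ≤ r - 1 ∧
          ∀ i : Fin (n + 1), p.eval (lam i) = lam (σ i) := by
  obtain ⟨i₀, hi₀⟩ : ∃ i, σ i ≠ i := by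
    by_contra! h
    exact hσ (Equiv.ext h)
  set j := σ i₀ with hj
  set s : Finset (Fin (n + 1)) := (Finset.univ.erase j).erase i₀ with hs
  have hcard : s.card = n - 1 := by
    rw [hs, Finset.card_erase_of_mem (by simp [hi₀.symm]), Finset.card_erase_of_mem (by simp)]
    simp
  let D : MvPolynomial (Fin (n + 1)) k := interpolateDenominator s MvPolynomial.X
  let N : MvPolynomial (Fin (n + 1)) k := interpolateNumerator s MvPolynomial.X
    (fun i => MvPolynomial.X (σ i)) (MvPolynomial.X i₀)
  have hD (lam : Fin (n + 1) → k) :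
      MvPolynomial.eval lam D = interpolateDenominator s lam := by
    simp [D, map_interpolateDenominator]
  have hN (lam : Fin (n + 1) → k) : MvPolynomial.eval lam N =
      interpolateNumerator s lam (fun i => lam (σ i)) (lam i₀) := by
    simp [N, map_interpolateNumerator]
  refine ⟨D * (D * MvPolynomial.X j - N), ?_, ?_⟩
  · let y : Fin (n + 1) → k := fun i => Infinite.natEmbedding k i
    have hy : Function.Injective y :=
      (Infinite.natEmbedding k).injective.comp Fin.val_injective
    let c : k := (Lagrange.interpolate s y (fun i => y (σ i))).eval (y i₀)
    let lam := Function.update y j (c + 1)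
    have hlam (i) (hi : i ≠ j) : lam i = y i := Function.update_of_ne hi _ _
    have hsj (i) (hi : i ∈ s) : i ≠ j := by
      simp only [hs, Finset.mem_erase] at hi
      exact hi.2.1
    have hinj : Set.InjOn lam s := by
      intro a ha b hb hab
      rw [hlam a (hsj a ha), hlam b (hsj b hb)] at hab
      exact hy hab
    have hden := (interpolateDenominator_ne_zero_iff s lam).mpr hinj
    have hnum : interpolateNumerator s lam (fun i => lam (σ i)) (lam i₀) =
        interpolateNumerator s y (fun i => y (σ i)) (y i₀) := by
      have hσs (i) (hi : i ∈ s) : lam (σ i) = y (σ i) := by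
        refine hlam _ fun h => ?_
        simp only [hs, Finset.mem_erase] at hi
        exact hi.1 (σ.injective h)
      rw [interpolateNumerator, interpolateNumerator, hlam i₀ hi₀.symm]
      refine Finset.sum_congr rfl fun i hi => ?_
      rw [hσs i hi]
      congr 2
      · exact Finset.prod_congr rfl fun l hl => by
          rw [hlam l (hsj l (Finset.mem_of_mem_erase hl))]
      · refine Finset.prod_congr rfl fun a ha => Finset.prod_congr rfl fun l hl => ?_
        rw [hlam l (hsj l (Finset.mem_of_mem_erase hl)),
          hlam a (hsj a (Finset.mem_of_mem_erase ha))]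
    have hdeny : interpolateDenominator s lam = interpolateDenominator s y :=
      Finset.prod_congr rfl fun a ha => Finset.prod_congr rfl fun l hl => by
        rw [hlam l (hsj l (Finset.mem_of_mem_erase hl)), hlam a (hsj a ha)]
    intro h0
    have h1 := congrArg (MvPolynomial.eval lam) h0
    have hlj : lam j = c + 1 := Function.update_self _ _ _
    rw [map_mul, map_sub, map_mul, MvPolynomial.eval_X, hD, hN, hnum,
      interpolateNumerator_eq s y _ _ hy.injOn, ← hdeny, map_zero, hlj, ← mul_sub] at h1
    change _ * (_ * (c + 1 - c)) = 0 at h1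
    rw [add_sub_cancel_left, mul_one] at h1
    exact mul_ne_zero hden hden h1
  · rintro lam hF ⟨p, hp, hpe⟩
    apply hF
    rw [map_mul, map_sub, map_mul, MvPolynomial.eval_X, hD, hN]
    by_cases hinj : Set.InjOn lam s
    · have hdeg : p.degree < s.card := by
        refine p.degree_le_natDegree.trans_lt ?_
        rw [hcard]
        exact_mod_cast (by omega : p.natDegree < n - 1)
      have hpi : p = Lagrange.interpolate s lam (fun i => lam (σ i)) :=
        Lagrange.eq_interpolate_of_eval_eq _ hinj hdeg fun i _ => hpe i
      rw [interpolateNumerator_eq s lam _ _ hinj, ← hpi, hpe i₀, sub_self, mul_zero]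
    · rw [not_ne_iff.mp (mt (interpolateDenominator_ne_zero_iff s lam).mp hinj), zero_mul]
end

section
/- Let d ≥ 1 and n ≥ 1 be natural numbers, and let k, s, t be elements of ℤ/dℤ satisfying: k + n = 0 in ℤ/dℤ, the element n + t is a unit in ℤ/dℤ, and s + t = k + 1 in ℤ/dℤ. Define the (n+1)×(n+1) matrix A over ℤ/dℤ whose i-th row, for 0 ≤ i ≤ n−1, has entry s in position i, entry t in position n, and entry 1 in every other position, and whose last row has entry 1 in positions 0,…,n−1 and entry k in position n. Then a vector x ∈ (ℤ/dℤ)^{n+1} satisfies A·x = 0 if and only if x is a constant vector, i.e., x = (a, a, …, a) for some a ∈ ℤ/dℤ. -/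
theorem stmt_5 (d n : ℕ) (hd : 1 ≤ d) (hn : 1 ≤ n) (k s t : ZMod d)
    (h1 : k + (n : ZMod d) = 0) (h2 : IsUnit ((n : ZMod d) + t)) (h3 : s + t = k + 1)
    (A : Matrix (Fin (n + 1)) (Fin (n + 1)) (ZMod d))
    (hA : A = fun i j =>
      if i = Fin.last n then (if j = Fin.last n then k else 1)
      else if j = i then s else if j = Fin.last n then t else 1)
    (x : Fin (n + 1) → ZMod d) :
    A.mulVec x = 0 ↔ ∃ a : ZMod d, x = fun _ => a := by
  have mulVec_last : A.mulVec x (Fin.last n) =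
      ∑ j : Fin n, x j.castSucc + k * x (Fin.last n) := by
    simp [hA, Matrix.mulVec, dotProduct, Fin.sum_univ_castSucc, Fin.castSucc_ne_last]
  have mulVec_castSucc (i : Fin n) : A.mulVec x i.castSucc =
      ∑ j : Fin n, x j.castSucc + (s - 1) * x i.castSucc + t * x (Fin.last n) := by
    have sum_row : ∑ j : Fin n, (if j = i then s else 1) * x j.castSucc =
        ∑ j : Fin n, x j.castSucc + (s - 1) * x i.castSucc := by
      have entry (j : Fin n) : (if j = i then s else 1) * x j.castSucc =
          x j.castSucc + if j = i then (s - 1) * x j.castSucc else 0 := by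
        split_ifs <;> ring
      simp [entry, Finset.sum_add_distrib]
    simp [hA, Matrix.mulVec, dotProduct, Fin.sum_univ_castSucc, Fin.castSucc_ne_last,
      (Fin.castSucc_ne_last _).symm, ← sum_row]
  constructor
  · intro h
    refine ⟨x (Fin.last n), funext fun i => ?_⟩
    induction i using Fin.lastCases with
    | last => rfl
    | cast i =>
      have hlast := mulVec_last.symm.trans (congrFun h (Fin.last n))
      have hi := (mulVec_castSucc i).symm.trans (congrFun h i.castSucc)
      simp only [Pi.zero_apply] at hlast hi
      apply h2.mul_left_cancel
      linear_combination hlast - hi + (x i.castSucc - x (Fin.last n)) * h1 +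
        x i.castSucc * h3
  · rintro ⟨a, rfl⟩
    funext i
    induction i using Fin.lastCases with
    | last =>
      rw [mulVec_last]
      simp only [Finset.sum_const, Finset.card_univ, Fintype.card_fin, nsmul_eq_mul, Pi.zero_apply]
      linear_combination a * h1
    | cast i =>
      rw [mulVec_castSucc]
      simp only [Finset.sum_const, Finset.card_univ, Fintype.card_fin, nsmul_eq_mul, Pi.zero_apply]
      linear_combination a * h1 + a * h3
end

section
/- Let p be an odd prime and let ζ be an element of the field ℚ_p of p-adic numbers such that ζ^m = 1 for some positive integer m. Then ζ^{p−1} = 1. -/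
/-- For odd `p`, a `p`-adic integer congruent to `1` modulo `p` which is a root of unity
equals `1`. -/
theorem PadicInt.eq_one_of_pow_eq_one_of_dvd_sub_one {p : ℕ} [Fact p.Prime] (hp : p ≠ 2)
    {m : ℕ} (hm : 0 < m) {x : ℤ_[p]} (hx : (p : ℤ_[p]) ∣ x - 1) (h : x ^ m = 1) : x = 1 := by
  have hprime : Prime (p : ℤ_[p]) := PadicInt.prime_p
  have hnx : ¬ (p : ℤ_[p]) ∣ x := fun hd =>
    hprime.not_dvd_one ((dvd_sub_right hd).1 hx)
  induction m using Nat.strong_induction_on generalizing x with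
  | _ m ih =>
    by_cases hpm : p ∣ m
    · obtain ⟨k, rfl⟩ := hpm
      have hk : 0 < k := Nat.pos_of_mul_pos_left hm
      have hxp : x ^ p = 1 := by
        refine ih k ?_ hk ?_ (by rw [← pow_mul, h]) (fun hd => hnx (hprime.dvd_of_dvd_pow hd))
        · exact lt_mul_of_one_lt_left hk (Fact.out : p.Prime).one_lt
        · exact hx.trans (by simpa using sub_dvd_pow_sub_pow x 1 p)
      have hmul := emultiplicity_pow_prime_sub_pow_prime hprime
        ((Fact.out : p.Prime).odd_of_ne_two hp) hx hnx
      rw [one_pow, hxp, sub_self, emultiplicity_zero] at hmul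
      by_contra hne
      have hfin : FiniteMultiplicity (p : ℤ_[p]) (x - 1) :=
        FiniteMultiplicity.of_not_isUnit hprime.not_isUnit (sub_ne_zero.2 hne)
      rw [hfin.emultiplicity_eq_multiplicity] at hmul
      exact ENat.natCast_ne_top _ (by exact_mod_cast hmul.symm)
    · have hpm' : ¬ (p : ℤ_[p]) ∣ (m : ℤ_[p]) := by
        rw [← PadicInt.norm_lt_one_iff_dvd]
        simpa [PadicInt.norm_natCast_lt_one_iff] using hpm
      have hgeom := not_dvd_geom_sum₂ hprime hx hnx hpm'
      have hmul := (Commute.all x 1).geom_sum₂_mul m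
      rw [h, one_pow, sub_self] at hmul
      rcases mul_eq_zero.1 hmul with h0 | h0
      · exact absurd (h0 ▸ dvd_zero _) hgeom
      · exact sub_eq_zero.1 h0

theorem stmt_9 (p : ℕ) [Fact p.Prime] (hp : p ≠ 2) (ζ : ℚ_[p]) (m : ℕ) (hm : 0 < m)
    (h : ζ ^ m = 1) : ζ ^ (p - 1) = 1 := by
  have hnorm : ‖ζ‖ = 1 := by
    refine (pow_eq_one_iff_of_nonneg (norm_nonneg ζ) hm.ne').1 ?_
    rw [← norm_pow, h, norm_one]
  obtain ⟨ζ, rfl⟩ : ∃ z : ℤ_[p], (z : ℚ_[p]) = ζ := ⟨⟨ζ, hnorm.le⟩, rfl⟩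
  have hz : ζ ^ m = 1 := PadicInt.ext (by simpa using h)
  have hdvd : (p : ℤ_[p]) ∣ ζ ^ (p - 1) - 1 := by
    rw [← Ideal.mem_span_singleton, ← PadicInt.maximalIdeal_eq_span_p, ← PadicInt.ker_toZMod,
      RingHom.mem_ker, map_sub, map_pow, map_one, sub_eq_zero]
    refine ZMod.pow_card_sub_one_eq_one fun h0 => ?_
    have := congrArg PadicInt.toZMod hz
    rw [map_pow, h0, zero_pow hm.ne', map_one] at this
    exact zero_ne_one this
  have key := PadicInt.eq_one_of_pow_eq_one_of_dvd_sub_one hp hm hdvd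
    (by rw [pow_right_comm, hz, one_pow])
  rw [← PadicInt.coe_pow, key, PadicInt.coe_one]
end

section
/- Let d ≥ 3 and let n₁, n₂ ≥ 1 be natural numbers, and set n := n₁ + n₂ − 1. Define e₁ := ∑_{0 ≤ j ≤ d, j even} C(n₁ + d − j − 1, d − j) · C(n₂ + j − 1, j) and e₂ := ∑_{0 ≤ j ≤ d, j odd} C(n₁ + d − j − 1, d − j) · C(n₂ + j − 1, j). Let r, f₁, f₂ be natural numbers with 2 ≤ r < n, f₁ + f₂ = r, f₁ ≤ e₁ and f₂ ≤ e₂. Then f₂·(e₁ − f₁) + f₁·(e₂ − f₂) > 2·n₁·n₂. -/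
/-- The dimension of the space of degree-`k` forms in `m ≥ 1` variables is monotone in `k`. -/
theorem choose_add_sub_one_mono {m k l : ℕ} (hm : 1 ≤ m) (hkl : k ≤ l) :
    (m + k - 1).choose k ≤ (m + l - 1).choose l := by
  obtain ⟨m, rfl⟩ := Nat.exists_eq_add_of_le' hm
  rw [show m + 1 + k - 1 = m + k by omega, show m + 1 + l - 1 = m + l by omega,
    Nat.choose_symm_add.symm, Nat.choose_symm_add.symm]
  exact Nat.choose_le_choose m (by omega)

theorem two_mul_choose_add_one_two (m : ℕ) : 2 * (m + 1).choose 2 = m * (m + 1) := by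
  induction m with
  | zero => simp
  | succ m ih =>
    have h := Nat.choose_succ_succ' (m + 1) 1
    norm_num at h
    rw [h]
    linarith

theorem six_mul_choose_add_two_three (m : ℕ) :
    6 * (m + 2).choose 3 = m * (m + 1) * (m + 2) := by
  induction m with
  | zero => simp
  | succ m ih =>
    have h := Nat.choose_succ_succ' (m + 2) 2
    norm_num at h
    rw [show m + 1 + 2 = m + 2 + 1 by ring, h]
    have := two_mul_choose_add_one_two (m + 1)
    linarith

/-- The cubic eigenspaces already have dimension exceeding `m * k + (m + k - 2)`. -/
theorem mul_add_add_lt_choose_three_add {m k : ℕ} (hm : 1 ≤ m) (hk : 1 ≤ k) :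
    m * k + (m + k) < (m + 2).choose 3 + m * (k + 1).choose 2 + 2 := by
  have h2 := two_mul_choose_add_one_two k
  have h3 := six_mul_choose_add_two_three m
  have h : 6 * (m * k + (m + k)) < m * (m + 1) * (m + 2) + 3 * (m * (k * (k + 1))) + 12 := by
    obtain rfl | rfl | hm : m = 1 ∨ m = 2 ∨ 3 ≤ m := by omega
    · zify; nlinarith [sq_nonneg (2 * (k : ℤ) - 3)]
    · zify; nlinarith [sq_nonneg ((k : ℤ) - 1)]
    · obtain ⟨p, rfl⟩ := Nat.exists_eq_add_of_le' hm
      zify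
      nlinarith [sq_nonneg ((k : ℤ) - 1), mul_nonneg (Int.natCast_nonneg p) (sq_nonneg ((k : ℤ) - 1)),
        pow_nonneg (Int.natCast_nonneg p) 2, pow_nonneg (Int.natCast_nonneg p) 3]
  rw [← h2, ← h3] at h
  nlinarith

theorem stmt_13 (d n₁ n₂ : ℕ) (hd : 3 ≤ d) (h1 : 1 ≤ n₁) (h2 : 1 ≤ n₂)
    (n : ℕ) (hn : n = n₁ + n₂ - 1)
    (e₁ e₂ : ℕ)
    (he₁ : e₁ = ∑ j ∈ (Finset.range (d + 1)).filter (fun j => Even j),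
      Nat.choose (n₁ + d - j - 1) (d - j) * Nat.choose (n₂ + j - 1) j)
    (he₂ : e₂ = ∑ j ∈ (Finset.range (d + 1)).filter (fun j => Odd j),
      Nat.choose (n₁ + d - j - 1) (d - j) * Nat.choose (n₂ + j - 1) j)
    (r f₁ f₂ : ℕ) (hr : 2 ≤ r) (hrn : r < n) (hf : f₁ + f₂ = r)
    (hf₁ : f₁ ≤ e₁) (hf₂ : f₂ ≤ e₂) :
    2 * n₁ * n₂ < f₂ * (e₁ - f₁) + f₁ * (e₂ - f₂) := by
  have mono (j : ℕ) (hj : j ≤ 3) : (n₁ + (3 - j) - 1).choose (3 - j) * (n₂ + j - 1).choose j ≤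
      (n₁ + d - j - 1).choose (d - j) * (n₂ + j - 1).choose j := by
    rw [show n₁ + d - j - 1 = n₁ + (d - j) - 1 by omega]
    exact Nat.mul_le_mul_right _ (choose_add_sub_one_mono h1 (by omega))
  have hE₁ : (n₁ + 2).choose 3 + n₁ * (n₂ + 1).choose 2 ≤ e₁ := by
    have hsub : ({0, 2} : Finset ℕ) ⊆ (Finset.range (d + 1)).filter (fun j => Even j) := by
      intro j hj
      obtain rfl | rfl : j = 0 ∨ j = 2 := by simpa using hj
      · simp
      · simp; omega
    rw [he₁]
    refine le_trans ?_ (Finset.sum_le_sum_of_subset hsub)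
    rw [Finset.sum_pair (by norm_num)]
    refine le_trans (le_of_eq ?_) (Nat.add_le_add (mono 0 (by norm_num)) (mono 2 (by norm_num)))
    simp
  have hE₂ : (n₂ + 2).choose 3 + n₂ * (n₁ + 1).choose 2 ≤ e₂ := by
    have hsub : ({3, 1} : Finset ℕ) ⊆ (Finset.range (d + 1)).filter (fun j => Odd j) := by
      intro j hj
      obtain rfl | rfl : j = 3 ∨ j = 1 := by simpa using hj
      · simp [show Odd 3 by decide]; omega
      · simp; omega
    rw [he₂]
    refine le_trans ?_ (Finset.sum_le_sum_of_subset hsub)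
    rw [Finset.sum_pair (by norm_num)]
    refine le_trans (le_of_eq ?_) (Nat.add_le_add (mono 3 (by norm_num)) (mono 1 (by norm_num)))
    simp [mul_comm]
  have hc₁ := mul_add_add_lt_choose_three_add h1 h2
  have hc₂ := mul_add_add_lt_choose_three_add h2 h1
  rw [mul_comm n₂ n₁] at hc₂
  have hd₁ : n₁ * n₂ + 1 ≤ e₁ - f₁ := by omega
  have hd₂ : n₁ * n₂ + 1 ≤ e₂ - f₂ := by omega
  calc 2 * n₁ * n₂ < 2 * (n₁ * n₂ + 1) := by linarith
    _ ≤ r * (n₁ * n₂ + 1) := Nat.mul_le_mul_right _ hr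
    _ = f₂ * (n₁ * n₂ + 1) + f₁ * (n₁ * n₂ + 1) := by rw [← hf]; ring
    _ ≤ f₂ * (e₁ - f₁) + f₁ * (e₂ - f₂) :=
      Nat.add_le_add (Nat.mul_le_mul_left _ hd₁) (Nat.mul_le_mul_left _ hd₂)
end

section
/- Let n₁, n₂ ≥ 1 be natural numbers, set n := n₁ + n₂ − 1, and define e₁ := C(n₁ + 1, 2) + C(n₂ + 1, 2) and e₂ := n₁·n₂. Let r, f₁, f₂ be natural numbers with 3 ≤ r < n, f₁ + f₂ = r, f₁ ≤ e₁ and f₂ ≤ e₂. Then f₂·(e₁ − f₁) + f₁·(e₂ − f₂) > 2·n₁·n₂. -/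
theorem add_mul_pos_of_endpoints_pos {a b x m : ℤ} (hx : 0 ≤ x) (hxm : x ≤ m)
    (h0 : 0 < a) (hm : 0 < a + b * m) : 0 < a + b * x := by
  rcases le_total 0 b with hb | hb
  · have := mul_nonneg hb hx
    linarith
  · have := mul_le_mul_of_nonpos_left hxm hb
    linarith

theorem two_mul_choose_succ_two (m : ℕ) : 2 * (Nat.choose (m + 1) 2 : ℤ) = m * (m + 1) := by
  have h : Nat.choose (m + 1) 2 * 2 = (m + 1) * m := by
    simpa using (Nat.add_one_mul_choose_eq m 1).symm
  have h' : (Nat.choose (m + 1) 2 : ℤ) * 2 = (m + 1) * m := by exact_mod_cast h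
  linarith

/-- Writing `s = n₁ + n₂` and `X = (n₁ - n₂) ^ 2`, four times the difference of the two sides of the
dimension estimate is affine in `X`; it is positive on `0 ≤ X ≤ (s - 2) ^ 2`. -/
theorem dimension_gap_pos {s X f₁ f₂ : ℤ} (hX : 0 ≤ X) (hXs : X ≤ (s - 2) ^ 2)
    (hf₂ : 0 ≤ f₂) (hr : 3 ≤ f₁ + f₂) (hs : f₁ + f₂ + 2 ≤ s) :
    0 < (f₁ + f₂ - 2) * (s ^ 2 - X) + 2 * f₂ * (X + s) - 8 * f₁ * f₂ := by
  have h0 : 0 < (f₁ + f₂ - 2) * s ^ 2 + 2 * f₂ * s - 8 * f₁ * f₂ := by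
    obtain ⟨r, hr'⟩ : ∃ r, r = f₁ + f₂ := ⟨_, rfl⟩
    have hprod : 4 * (f₁ * f₂) ≤ r ^ 2 := by
      rw [hr']
      nlinarith [sq_nonneg (f₁ - f₂)]
    rw [← hr'] at hr hs ⊢
    have hsq : (r + 2) ^ 2 ≤ s ^ 2 := by gcongr
    have h1 : (r - 2) * (r + 2) ^ 2 ≤ (r - 2) * s ^ 2 :=
      mul_le_mul_of_nonneg_left hsq (by linarith)
    have h2 : 2 * r ^ 2 < (r - 2) * (r + 2) ^ 2 := by
      nlinarith [mul_nonneg (sub_nonneg.2 hr) (sq_nonneg r)]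
    have h3 : 0 ≤ f₂ * s := mul_nonneg hf₂ (by linarith)
    linarith
  have h1 : 0 < 4 * (f₁ + f₂ - 2) * (s - 1) + 2 * f₂ * (s ^ 2 - 3 * s + 4) - 8 * f₁ * f₂ := by
    have h2 : 0 < (f₁ + f₂ - 2) * (s - 1) := mul_pos (by linarith) (by linarith)
    have h3 : 0 ≤ f₂ * ((s - 3) * (s - 4)) :=
      mul_nonneg hf₂ (mul_nonneg (by linarith) (by linarith))
    have h4 : 0 ≤ f₂ * (s - 2 - f₁) := mul_nonneg hf₂ (by linarith)
    linarith
  have := add_mul_pos_of_endpoints_pos (b := 2 * f₂ - (f₁ + f₂ - 2)) hX hXs h0 (by linarith)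
  linarith

theorem stmt_14 (n₁ n₂ : ℕ) (h1 : 1 ≤ n₁) (h2 : 1 ≤ n₂)
    (n : ℕ) (hn : n = n₁ + n₂ - 1)
    (e₁ e₂ : ℕ) (he₁ : e₁ = Nat.choose (n₁ + 1) 2 + Nat.choose (n₂ + 1) 2)
    (he₂ : e₂ = n₁ * n₂)
    (r f₁ f₂ : ℕ) (hr : 3 ≤ r) (hrn : r < n) (hf : f₁ + f₂ = r)
    (hf₁ : f₁ ≤ e₁) (hf₂ : f₂ ≤ e₂) :
    2 * n₁ * n₂ < f₂ * (e₁ - f₁) + f₁ * (e₂ - f₂) := by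
  have hr' : (3 : ℤ) ≤ f₁ + f₂ := by omega
  have hs : (f₁ : ℤ) + f₂ + 2 ≤ n₁ + n₂ := by omega
  have hX : ((n₁ : ℤ) - n₂) ^ 2 ≤ (n₁ + n₂ - 2) ^ 2 := by
    apply sq_le_sq'
    · omega
    · omega
  have hgap := dimension_gap_pos (sq_nonneg ((n₁ : ℤ) - n₂)) hX
    (Int.natCast_nonneg f₂) hr' hs
  have he₁' : 2 * (e₁ : ℤ) = n₁ * (n₁ + 1) + n₂ * (n₂ + 1) := by
    rw [he₁, ← two_mul_choose_succ_two, ← two_mul_choose_succ_two]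
    push_cast
    ring
  have he₂' : (e₂ : ℤ) = n₁ * n₂ := by exact_mod_cast he₂
  zify [hf₁, hf₂]
  rw [he₂']
  have he : (f₂ : ℤ) * (2 * e₁) = f₂ * (n₁ * (n₁ + 1) + n₂ * (n₂ + 1)) := by rw [he₁']
  linarith
end

section
/- Let k be an algebraically closed field, n ≥ 1, and let a₀,…,aₙ ∈ k be scalars that are not all equal. Then there exists a nonzero polynomial F in n+1 variables over k such that: for every tuple (λ₀,…,λₙ) ∈ k^{n+1} of pairwise distinct elements with F(λ₀,…,λₙ) ≠ 0, every one-variable polynomial p ∈ k[t] satisfying p(λᵢ) = aᵢ for all 0 ≤ i ≤ n has degree ≥ n. -/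
/-- The Vandermonde matrix with columns `1, x, …, x ^ (n - 1)`, bordered by the column `a`. -/
def borderedVandermonde {R : Type*} [CommRing R] {n : ℕ} (x a : Fin (n + 1) → R) :
    Matrix (Fin (n + 1)) (Fin (n + 1)) R :=
  Matrix.of fun i => Fin.snoc (α := fun _ => R) (fun j : Fin n => x i ^ (j : ℕ)) (a i)

theorem borderedVandermonde_mulVec {R : Type*} [CommRing R] {n : ℕ} (x a v : Fin (n + 1) → R)
    (i : Fin (n + 1)) :
    (borderedVandermonde x a).mulVec v i =
      (∑ j : Fin n, x i ^ (j : ℕ) * v j.castSucc) + a i * v (Fin.last n) := by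
  simp [borderedVandermonde, Matrix.mulVec, dotProduct, Fin.sum_univ_castSucc]

theorem eval_det_borderedVandermonde {R : Type*} [CommRing R] {n : ℕ} (x a : Fin (n + 1) → R) :
    MvPolynomial.eval x
        (borderedVandermonde MvPolynomial.X fun i => MvPolynomial.C (a i)).det =
      (borderedVandermonde x a).det := by
  rw [RingHom.map_det]
  congr 1
  ext i j
  refine Fin.lastCases ?_ (fun j => ?_) j <;> simp [borderedVandermonde]

/-- The bordered determinant vanishes if `a` is interpolated by a polynomial of degree `< n`. -/
theorem det_borderedVandermonde_eq_zero {k : Type*} [Field k] {n : ℕ} {x a : Fin (n + 1) → k}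
    {p : Polynomial k} (hp : ∀ i, p.eval (x i) = a i) (hdeg : p.natDegree < n) :
    (borderedVandermonde x a).det = 0 := by
  refine Matrix.exists_mulVec_eq_zero_iff.mp
    ⟨Fin.snoc (α := fun _ => k) (fun j : Fin n => p.coeff j) (-1), fun h => ?_, ?_⟩
  · simpa using congrFun h (Fin.last n)
  · ext i
    rw [borderedVandermonde_mulVec, ← hp i, Polynomial.eval_eq_sum_range' hdeg,
      ← Fin.sum_univ_eq_sum_range fun j => p.coeff j * x i ^ j]
    simp [mul_comm]

/-- If exactly two nodes coincide and carry different data, the bordered determinant is nonzero. -/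
theorem det_borderedVandermonde_ne_zero {k : Type*} [Field k] {n : ℕ} {x a : Fin (n + 1) → k}
    {i j : Fin (n + 1)} (hx : x i = x j) (ha : a i ≠ a j) (hinj : Set.InjOn x {i}ᶜ) :
    (borderedVandermonde x a).det ≠ 0 := by
  intro hdet
  obtain ⟨v, hv, hmul⟩ := Matrix.exists_mulVec_eq_zero_iff.mpr hdet
  have heq (l : Fin (n + 1)) :
      (∑ m : Fin n, x l ^ (m : ℕ) * v m.castSucc) + a l * v (Fin.last n) = 0 := by
    rw [← borderedVandermonde_mulVec, hmul, Pi.zero_apply]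
  have hlast : v (Fin.last n) = 0 := by
    have hi := heq i
    rw [hx] at hi
    have h : (a i - a j) * v (Fin.last n) = 0 := by linear_combination hi - heq j
    exact (mul_eq_zero.mp h).resolve_left (sub_ne_zero.mpr ha)
  have hq : (∑ m : Fin n, Polynomial.C (v m.castSucc) * Polynomial.X ^ (m : ℕ)) = 0 := by
    refine Polynomial.eq_zero_of_degree_lt_of_eval_index_eq_zero (v := x) (Finset.univ.erase i)
      (hinj.mono fun l hl => (Finset.mem_erase.mp hl).1) ?_ fun l _ => ?_
    · simpa using Polynomial.degree_sum_fin_lt fun m : Fin n => v m.castSucc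
    · have hl := heq l
      rw [hlast, mul_zero, add_zero] at hl
      simpa only [Polynomial.eval_finsetSum, Polynomial.eval_mul, Polynomial.eval_C,
        Polynomial.eval_pow, Polynomial.eval_X, mul_comm] using hl
  refine hv (funext fun l => Fin.lastCases hlast (fun m => ?_) l)
  simpa [Polynomial.finsetSum_coeff, Polynomial.coeff_X_pow, Fin.val_inj] using
    congrArg (fun q => Polynomial.coeff q (m : ℕ)) hq

theorem stmt_15 (k : Type*) [Field k] [IsAlgClosed k] (n : ℕ) (hn : 1 ≤ n)
    (a : Fin (n + 1) → k) (ha : ∃ i j, a i ≠ a j) :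
    ∃ F : MvPolynomial (Fin (n + 1)) k, F ≠ 0 ∧
      ∀ lam : Fin (n + 1) → k, Function.Injective lam →
        MvPolynomial.eval lam F ≠ 0 →
          ∀ p : Polynomial k, (∀ i, p.eval (lam i) = a i) → n ≤ p.natDegree := by
  refine ⟨(borderedVandermonde MvPolynomial.X fun i => MvPolynomial.C (a i)).det, fun hF => ?_,
    fun lam _ hF p hp => ?_⟩
  · obtain ⟨i, j, hij⟩ := ha
    let f : Fin (n + 1) → k := fun l => Infinite.natEmbedding k l
    have hf : Function.Injective f := (Infinite.natEmbedding k).injective.comp Fin.val_injective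
    have hji : j ≠ i := fun h => hij (h ▸ rfl)
    refine det_borderedVandermonde_ne_zero (x := Function.update f i (f j)) (by simp [hji]) hij
      (fun l hl m hm h => hf ?_) ?_
    · rwa [Function.update_of_ne hl, Function.update_of_ne hm] at h
    · rw [← eval_det_borderedVandermonde, hF, map_zero]
  · by_contra! hdeg
    exact hF (by rw [eval_det_borderedVandermonde, det_borderedVandermonde_eq_zero hp hdeg])
end
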